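/- Let f, g and h be entire functions given by everywhere absolutely convergent vector valued Dirichlet series, and let p ≥ 0, q ≥ 0, m ≥ 0 be integers. Assume 0 < λ_h^{(m,q)}(f) ≤ ρ_h^{(m,q)}(f) < +∞, 0 < λ_h^{(m,p)}(g) ≤ ρ_h^{(m,p)}(g) < +∞, and that the type indicators Δ_h^{(m,q)}(f), Δ̄_h^{(m,q)}(f), Δ_h^{(m,p)}(g), Δ̄_h^{(m,p)}(g), τ_h^{(m,p)}(g), τ̄_h^{(m,p)}(g) are all positive and finite. Then max{ (Δ̄_h^{(m,q)}(f)/τ_h^{(m,p)}(g))^{1/λ_h^{(m,p)}(g)}, (Δ_h^{(m,q)}(f)/τ̄_h^{(m,p)}(g))^{1/λ_h^{(m,p)}(g)} } ≤ Δ_g^{(p,q)}(f) ≤ (Δ_h^{(m,q)}(f)/Δ̄_h^{(m,p)}(g))^{1/ρ_h^{(m,p)}(g)}. -/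

import Mathlib

open Filter Topology

noncomputable section

/-- An entire function given by an everywhere absolutely convergent
vector valued Dirichlet series, with coefficients in a Banach space `E`. -/
structure VVDS (E : Type*) [NormedAddCommGroup E] [NormedSpace ℂ E] [CompleteSpace E] where
  a : ℕ → E
  lam : ℕ → ℝ
  lam_pos : ∀ n, 0 < lam n
  lam_strictMono : StrictMono lam
  lam_tendsto : Tendsto lam atTop atTop
  log_index_bound : ∃ D : ℝ, ∀ᶠ n : ℕ in atTop, Real.log (n : ℝ) / lam n ≤ D
  coeff_decay : Tendsto (fun n => Real.log ‖a n‖ / lam n) atTop atBot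
  abs_conv : ∀ s : ℂ, Summable (fun n => Real.exp (s.re * lam n) * ‖a n‖)

variable {E F G : Type*} [NormedAddCommGroup E] [NormedSpace ℂ E] [CompleteSpace E]
  [NormedAddCommGroup F] [NormedSpace ℂ F] [CompleteSpace F]
  [NormedAddCommGroup G] [NormedSpace ℂ G] [CompleteSpace G]

/-- The entire function defined by the vector valued Dirichlet series. -/
def VVDS.toFun (f : VVDS E) (s : ℂ) : E := ∑' n, Complex.exp (s * (f.lam n : ℂ)) • f.a n

/-- The maximum modulus function `M_f(σ) = sup_t ‖f(σ+it)‖`. -/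
def VVDS.M (f : VVDS E) (σ : ℝ) : ℝ := ⨆ t : ℝ, ‖f.toFun ((σ : ℂ) + (t : ℂ) * Complex.I)‖

/-- The inverse function of the maximum modulus function. -/
def VVDS.Minv (f : VVDS E) (y : ℝ) : ℝ := sInf {σ : ℝ | y ≤ f.M σ}

/-- The (p,q)-th relative Ritt order of `f` with respect to `g`. -/
def relRittOrder (p q : ℕ) (f : VVDS E) (g : VVDS F) : EReal :=
  limsup (fun σ : ℝ =>
    ((Real.log^[p] (g.Minv (f.M σ)) / Real.log^[q] σ : ℝ) : EReal)) atTop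

/-- The (p,q)-th relative Ritt lower order of `f` with respect to `g`. -/
def relRittLowerOrder (p q : ℕ) (f : VVDS E) (g : VVDS F) : EReal :=
  liminf (fun σ : ℝ =>
    ((Real.log^[p] (g.Minv (f.M σ)) / Real.log^[q] σ : ℝ) : EReal)) atTop

/-- The (p,q)-th relative Ritt type of `f` with respect to `g`. -/
def relRittType (p q : ℕ) (f : VVDS E) (g : VVDS F) : EReal :=
  limsup (fun σ : ℝ =>
    ((Real.log^[p-1] (g.Minv (f.M σ)) /
      (Real.log^[q-1] σ) ^ (relRittOrder p q f g).toReal : ℝ) : EReal)) atTop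

/-- The (p,q)-th relative Ritt lower type of `f` with respect to `g`. -/
def relRittLowerType (p q : ℕ) (f : VVDS E) (g : VVDS F) : EReal :=
  liminf (fun σ : ℝ =>
    ((Real.log^[p-1] (g.Minv (f.M σ)) /
      (Real.log^[q-1] σ) ^ (relRittOrder p q f g).toReal : ℝ) : EReal)) atTop

/-- The (p,q)-th relative Ritt weak type of `f` with respect to `g`. -/
def relRittWeakType (p q : ℕ) (f : VVDS E) (g : VVDS F) : EReal :=
  liminf (fun σ : ℝ =>
    ((Real.log^[p-1] (g.Minv (f.M σ)) /
      (Real.log^[q-1] σ) ^ (relRittLowerOrder p q f g).toReal : ℝ) : EReal)) atTop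

/-- The growth indicator `τ̄_g^{(p,q)}(f)`. -/
def relRittUpperWeakType (p q : ℕ) (f : VVDS E) (g : VVDS F) : EReal :=
  limsup (fun σ : ℝ =>
    ((Real.log^[p-1] (g.Minv (f.M σ)) /
      (Real.log^[q-1] σ) ^ (relRittLowerOrder p q f g).toReal : ℝ) : EReal)) atTop

section PartOne

lemma VVDS.norm_term (f : VVDS E) (s : ℂ) (n : ℕ) :
    ‖Complex.exp (s * (f.lam n : ℂ)) • f.a n‖ = Real.exp (s.re * f.lam n) * ‖f.a n‖ := by
  rw [norm_smul, Complex.norm_exp]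
  simp

lemma VVDS.summable_real (f : VVDS E) (σ : ℝ) :
    Summable (fun n => Real.exp (σ * f.lam n) * ‖f.a n‖) := by
  simpa using f.abs_conv (σ : ℂ)

/-- The majorant. -/
def VVDS.S (f : VVDS E) (σ : ℝ) : ℝ := ∑' n, Real.exp (σ * f.lam n) * ‖f.a n‖

lemma VVDS.norm_le_S (f : VVDS E) (s : ℂ) : ‖f.toFun s‖ ≤ f.S s.re := by
  have := norm_tsum_le_tsum_norm (f := fun n => Complex.exp (s * (f.lam n : ℂ)) • f.a n)
    (by simpa only [f.norm_term] using f.abs_conv s)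
  simp only [f.norm_term] at this
  exact this

lemma VVDS.S_mono (f : VVDS E) : Monotone f.S := by
  intro x y hxy
  refine (f.summable_real x).tsum_le_tsum (fun n => ?_) (f.summable_real y)
  have := (f.lam_pos n).le
  gcongr

lemma VVDS.bdd (f : VVDS E) (σ : ℝ) :
    BddAbove (Set.range fun t : ℝ => ‖f.toFun ((σ : ℂ) + (t : ℂ) * Complex.I)‖) := by
  refine ⟨f.S σ, ?_⟩
  rintro _ ⟨t, rfl⟩
  simpa using f.norm_le_S ((σ : ℂ) + (t : ℂ) * Complex.I)

lemma VVDS.M_le_S (f : VVDS E) (σ : ℝ) : f.M σ ≤ f.S σ := by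
  refine ciSup_le fun t => ?_
  simpa using f.norm_le_S ((σ : ℂ) + (t : ℂ) * Complex.I)

lemma VVDS.norm_le_M (f : VVDS E) (s : ℂ) : ‖f.toFun s‖ ≤ f.M s.re := by
  have := le_ciSup (f.bdd s.re) s.im
  simpa [VVDS.M] using this

lemma VVDS.M_nonneg (f : VVDS E) (σ : ℝ) : 0 ≤ f.M σ :=
  Real.iSup_nonneg fun _ => norm_nonneg _

lemma VVDS.S_le (f : VVDS E) {σ : ℝ} (hσ : σ ≤ 0) : f.S σ ≤ Real.exp (σ * f.lam 0) * f.S 0 := by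
  rw [VVDS.S, VVDS.S, ← tsum_mul_left]
  refine (f.summable_real σ).tsum_le_tsum (fun n => ?_) ((f.summable_real 0).mul_left _)
  have h1 : f.lam 0 ≤ f.lam n := f.lam_strictMono.monotone (Nat.zero_le n)
  have h2 : σ * f.lam n ≤ σ * f.lam 0 := mul_le_mul_of_nonpos_left h1 hσ
  simp only [zero_mul, Real.exp_zero, one_mul]
  gcongr

lemma VVDS.M_tendsto_zero (f : VVDS E) : Tendsto f.M atBot (𝓝 0) := by
  have h1 : Tendsto (fun σ : ℝ => Real.exp (σ * f.lam 0) * f.S 0) atBot (𝓝 0) := by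
    have : Tendsto (fun σ : ℝ => Real.exp (σ * f.lam 0)) atBot (𝓝 0) :=
      Real.tendsto_exp_atBot.comp (tendsto_id.atBot_mul_const (f.lam_pos 0))
    simpa using this.mul_const (f.S 0)
  refine squeeze_zero' (Eventually.of_forall f.M_nonneg) ?_ h1
  filter_upwards [eventually_le_atBot (0 : ℝ)] with σ hσ
  exact (f.M_le_S σ).trans (f.S_le hσ)

lemma VVDS.differentiable (f : VVDS E) : Differentiable ℂ f.toFun := by
  intro s
  have hU : IsOpen {w : ℂ | w.re < s.re + 1} := isOpen_lt Complex.continuous_re continuous_const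
  have := Complex.differentiableOn_tsum_of_summable_norm
    (F := fun n (w : ℂ) => Complex.exp (w * (f.lam n : ℂ)) • f.a n) (U := {w : ℂ | w.re < s.re + 1})
    (f.summable_real (s.re + 1)) ?_ hU ?_
  · exact this.differentiableAt (hU.mem_nhds (by simp))
  · intro n
    apply Differentiable.differentiableOn
    fun_prop
  · intro n w hw
    rw [f.norm_term]
    have := (f.lam_pos n).le
    have h2 : w.re ≤ s.re + 1 := le_of_lt hw
    gcongr

lemma VVDS.three_lines (f : VVDS E) {l x u : ℝ} (hlx : l ≤ x) (hxu : x ≤ u) (hlu : l < u) :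
    f.M x ≤ f.M l ^ (1 - (x - l) / (u - l)) * f.M u ^ ((x - l) / (u - l)) := by
  refine ciSup_le fun t => ?_
  have := Complex.HadamardThreeLines.norm_le_interp_of_mem_verticalClosedStrip'
    (f := f.toFun) (z := (x : ℂ) + (t : ℂ) * Complex.I) (a := f.M l) (b := f.M u) hlu ?_
    f.differentiable.diffContOnCl ?_ ?_ ?_
  · simpa using this
  · simp [Complex.HadamardThreeLines.verticalClosedStrip, hlx, hxu]
  · refine ⟨f.S u, ?_⟩
    rintro _ ⟨z, hz, rfl⟩
    exact (f.norm_le_S z).trans (f.S_mono hz.2)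
  · intro z hz
    have : z.re = l := hz
    rw [← this]; exact f.norm_le_M z
  · intro z hz
    have : z.re = u := hz
    rw [← this]; exact f.norm_le_M z

lemma VVDS.exists_ne (f : VVDS E) : ∃ n, f.a n ≠ 0 := by
  obtain ⟨n, hn⟩ := (f.coeff_decay.eventually (eventually_lt_atBot (0 : ℝ))).exists
  refine ⟨n, fun h => ?_⟩
  simp [h] at hn

lemma VVDS.M_pos (f : VVDS E) (σ : ℝ) : 0 < f.M σ := by
  classical
  refine lt_of_le_of_ne (f.M_nonneg σ) fun h0 => ?_
  have hz : ∀ x < σ, f.M x = 0 := by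
    intro x hx
    have h := f.three_lines (l := x - 1) (x := x) (u := σ) (by linarith) hx.le (by linarith)
    rw [← h0, Real.zero_rpow, mul_zero] at h
    · exact le_antisymm h (f.M_nonneg x)
    · have : 0 < σ - (x - 1) := by linarith
      have : 0 < (x - (x - 1)) / (σ - (x - 1)) := by
        apply div_pos _ this; linarith
      exact this.ne'
  set n := Nat.find f.exists_ne with hn
  have hne : f.a n ≠ 0 := Nat.find_spec f.exists_ne
  have hlt : ∀ k < n, f.a k = 0 := fun k hk => by
    simpa using Nat.find_min f.exists_ne hk
  have key : ∀ x < min σ 0, ‖f.a n‖ ≤ Real.exp (x * (f.lam (n + 1) - f.lam n)) * f.S 0 := by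
    intro x hx
    have hx1 : x < σ := lt_of_lt_of_le hx (min_le_left _ _)
    have hx2 : x < 0 := lt_of_lt_of_le hx (min_le_right _ _)
    have hfz : f.toFun (x : ℂ) = 0 := by
      have := f.norm_le_M (x : ℂ)
      rw [Complex.ofReal_re, hz x hx1] at this
      simpa using this
    have hs : Summable fun k => Complex.exp ((x : ℂ) * (f.lam k : ℂ)) • f.a k := by
      apply Summable.of_norm
      simpa only [f.norm_term] using f.abs_conv x
    rw [VVDS.toFun, hs.tsum_eq_add_tsum_ite n] at hfz
    have hb := tsum_of_norm_bounded (f := fun k => if k = n then (0 : E) else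
      Complex.exp ((x : ℂ) * (f.lam k : ℂ)) • f.a k)
      ((f.summable_real 0).mul_left (Real.exp (x * f.lam (n + 1)))).hasSum ?_
    · rw [eq_neg_of_add_eq_zero_right hfz, norm_neg, f.norm_term, tsum_mul_left] at hb
      rw [mul_sub, Real.exp_sub, div_mul_eq_mul_div, le_div_iff₀ (Real.exp_pos _), mul_comm]
      simpa [VVDS.S] using hb
    · intro k
      rcases lt_trichotomy k n with hk | hk | hk
      · simp [hlt k hk]
      · simp only [hk, if_true, norm_zero]; positivity
      · have h1 : f.lam (n + 1) ≤ f.lam k := f.lam_strictMono.monotone hk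
        have h2 : x * f.lam k ≤ x * f.lam (n + 1) := mul_le_mul_of_nonpos_left h1 hx2.le
        rw [if_neg hk.ne', f.norm_term]
        simp only [zero_mul, Real.exp_zero, one_mul, Complex.ofReal_re]
        gcongr
  have hlim : Tendsto (fun x : ℝ => Real.exp (x * (f.lam (n + 1) - f.lam n)) * f.S 0)
      atBot (𝓝 0) := by
    have : Tendsto (fun x : ℝ => Real.exp (x * (f.lam (n + 1) - f.lam n))) atBot (𝓝 0) :=
      Real.tendsto_exp_atBot.comp
        (tendsto_id.atBot_mul_const (sub_pos.2 (f.lam_strictMono (Nat.lt_succ_self n))))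
    simpa using this.mul_const (f.S 0)
  have := ge_of_tendsto hlim ((eventually_lt_atBot (min σ 0)).mono key)
  exact hne (norm_le_zero_iff.1 this)

lemma VVDS.log_M_convex (f : VVDS E) : ConvexOn ℝ Set.univ (fun x => Real.log (f.M x)) := by
  refine convexOn_of_slope_mono_adjacent convex_univ ?_
  intro x y z _ _ hxy hyz
  have h := f.three_lines hxy.le hyz.le (hxy.trans hyz)
  have h2 := Real.log_le_log (f.M_pos y) h
  rw [Real.log_mul (Real.rpow_pos_of_pos (f.M_pos _) _).ne'
    (Real.rpow_pos_of_pos (f.M_pos _) _).ne', Real.log_rpow (f.M_pos _),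
    Real.log_rpow (f.M_pos _)] at h2
  have h3 : 0 < z - x := by linarith
  have h4 : (z - x) * Real.log (f.M y) ≤
      (z - y) * Real.log (f.M x) + (y - x) * Real.log (f.M z) := by
    have := mul_le_mul_of_nonneg_left h2 h3.le
    refine this.trans (le_of_eq ?_)
    field_simp
    ring
  rw [div_le_div_iff₀ (by linarith) (by linarith)]
  nlinarith

lemma VVDS.M_continuous (f : VVDS E) : Continuous f.M := by
  have h := f.log_M_convex.continuousOn isOpen_univ
  have h2 : Continuous (fun x => Real.exp (Real.log (f.M x))) :=
    Real.continuous_exp.comp (continuousOn_univ.1 h)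
  simpa only [Real.exp_log (f.M_pos _)] using h2

lemma VVDS.M_strictMono (f : VVDS E) : StrictMono f.M := by
  intro x y hxy
  obtain ⟨l, hl1, hl2⟩ := ((f.M_tendsto_zero.eventually (gt_mem_nhds (f.M_pos y))).and
    (eventually_lt_atBot x)).exists
  refine (f.three_lines hl2.le hxy.le (hl2.trans hxy)).trans_lt ?_
  have h3 : 0 < y - l := by linarith
  have h1 : 0 < 1 - (x - l) / (y - l) := by
    rw [sub_pos, div_lt_one h3]; linarith
  calc f.M l ^ (1 - (x - l) / (y - l)) * f.M y ^ ((x - l) / (y - l))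
      < f.M y ^ (1 - (x - l) / (y - l)) * f.M y ^ ((x - l) / (y - l)) := by
        have := f.M_pos y
        have := Real.rpow_lt_rpow (f.M_pos l).le hl1 h1
        gcongr
    _ = f.M y := by
        rw [← Real.rpow_add (f.M_pos y)]; simp

lemma VVDS.M_tendsto_top (f : VVDS E) : Tendsto f.M atTop atTop := by
  have hlin : ∀ z : ℝ, 1 < z →
      Real.log (f.M 1) + (z - 1) * (Real.log (f.M 1) - Real.log (f.M 0)) ≤ Real.log (f.M z) := by
    intro z hz
    have := f.log_M_convex.slope_mono_adjacent (Set.mem_univ 0) (Set.mem_univ z) one_pos hz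
    rw [div_le_div_iff₀ (by linarith) (by linarith)] at this
    linarith
  have hpos : 0 < Real.log (f.M 1) - Real.log (f.M 0) :=
    sub_pos.2 (Real.log_lt_log (f.M_pos 0) (f.M_strictMono one_pos))
  have h1 : Tendsto (fun z : ℝ => Real.log (f.M 1) + (z - 1) * (Real.log (f.M 1) - Real.log (f.M 0)))
      atTop atTop :=
    tendsto_atTop_add_const_left _ _ ((tendsto_atTop_add_const_right _ (-1) tendsto_id).atTop_mul_const hpos)
  have h2 := tendsto_atTop_mono' _ ((eventually_gt_atTop (1 : ℝ)).mono hlin) h1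
  have h3 := Real.tendsto_exp_atTop.comp h2
  refine h3.congr fun x => ?_
  simp [Real.exp_log (f.M_pos x)]

lemma VVDS.M_surj (f : VVDS E) {y : ℝ} (hy : 0 < y) : ∃ x, f.M x = y := by
  obtain ⟨a, ha⟩ := (f.M_tendsto_zero.eventually (gt_mem_nhds hy)).exists
  obtain ⟨b, hb⟩ := (f.M_tendsto_top.eventually (eventually_gt_atTop y)).exists
  exact mem_range_of_exists_le_of_exists_ge f.M_continuous ⟨a, ha.le⟩ ⟨b, hb.le⟩

lemma VVDS.Minv_M (f : VVDS E) (x : ℝ) : f.Minv (f.M x) = x := by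
  have : {σ : ℝ | f.M x ≤ f.M σ} = Set.Ici x := by
    ext σ; simp [f.M_strictMono.le_iff_le]
  rw [VVDS.Minv, this, csInf_Ici]

lemma VVDS.M_Minv (f : VVDS E) {y : ℝ} (hy : 0 < y) : f.M (f.Minv y) = y := by
  obtain ⟨x, rfl⟩ := f.M_surj hy
  rw [f.Minv_M]

lemma VVDS.rel_tendsto (f : VVDS E) (g : VVDS F) :
    Tendsto (fun σ => g.Minv (f.M σ)) atTop atTop := by
  refine tendsto_atTop.2 fun b => ?_
  filter_upwards [f.M_tendsto_top.eventually (eventually_ge_atTop (g.M b))] with σ hσ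
  rw [← g.M_strictMono.le_iff_le, g.M_Minv (f.M_pos σ)]
  exact hσ

lemma VVDS.rel_comp (f : VVDS E) (g : VVDS F) (h : VVDS G) (σ : ℝ) :
    h.Minv (g.M (g.Minv (f.M σ))) = h.Minv (f.M σ) := by
  rw [g.M_Minv (f.M_pos σ)]

lemma VVDS.rel_map (f : VVDS E) (g : VVDS F) :
    map (fun σ => g.Minv (f.M σ)) atTop = atTop := by
  refine le_antisymm (f.rel_tendsto g) ?_
  have h1 := (f.rel_tendsto g).comp (g.rel_tendsto f)
  calc atTop = map ((fun σ => g.Minv (f.M σ)) ∘ fun σ => f.Minv (g.M σ)) atTop := by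
        rw [show ((fun σ => g.Minv (f.M σ)) ∘ fun σ => f.Minv (g.M σ)) = id from ?_, map_id]
        funext σ
        simp [f.M_Minv (g.M_pos σ), g.Minv_M]
    _ = map (fun σ => g.Minv (f.M σ)) (map (fun σ => f.Minv (g.M σ)) atTop) := by rw [map_map]
    _ ≤ _ := map_mono (g.rel_tendsto f)

end PartOne

section PartTwo

lemma ev_lower {u : ℝ → ℝ} (h : (0 : EReal) < liminf (fun σ => ((u σ : ℝ) : EReal)) atTop) :
    ∃ c : ℝ, 0 < c ∧ ∀ᶠ σ in atTop, c < u σ := by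
  obtain ⟨c, h1, h2⟩ := EReal.lt_iff_exists_real_btwn.1 h
  refine ⟨c, by exact_mod_cast h1, ?_⟩
  filter_upwards [eventually_lt_of_lt_liminf h2] with σ hσ
  exact_mod_cast hσ

lemma ev_upper {u : ℝ → ℝ} (h : limsup (fun σ => ((u σ : ℝ) : EReal)) atTop < ⊤) :
    ∃ C : ℝ, ∀ᶠ σ in atTop, u σ < C := by
  obtain ⟨c, h1, h2⟩ := EReal.lt_iff_exists_real_btwn.1 h
  refine ⟨c, ?_⟩
  filter_upwards [eventually_lt_of_limsup_lt h1] with σ hσ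
  exact_mod_cast hσ

/-- Limsup of a power quotient. -/
lemma quot_lemma {a b w : ℝ → ℝ} {A1 A2 B1 B2 ρ : ℝ} (hρ : 0 < ρ)
    (hA1 : liminf (fun σ => ((a σ : ℝ) : EReal)) atTop = (A1 : EReal))
    (hA2 : limsup (fun σ => ((a σ : ℝ) : EReal)) atTop = (A2 : EReal))
    (hB1 : liminf (fun σ => ((b σ : ℝ) : EReal)) atTop = (B1 : EReal))
    (hB2 : limsup (fun σ => ((b σ : ℝ) : EReal)) atTop = (B2 : EReal))
    (pA1 : 0 < A1) (pA2 : 0 < A2) (pB1 : 0 < B1) (pB2 : 0 < B2)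
    (hw : ∀ᶠ σ in atTop, 0 < w σ) (hb : ∀ᶠ σ in atTop, 0 < b σ)
    (hwab : ∀ᶠ σ in atTop, w σ ^ ρ * b σ = a σ) :
    (((A1 / B1) ^ (1 / ρ) : ℝ) : EReal) ≤ limsup (fun σ => ((w σ : ℝ) : EReal)) atTop ∧
    (((A2 / B2) ^ (1 / ρ) : ℝ) : EReal) ≤ limsup (fun σ => ((w σ : ℝ) : EReal)) atTop ∧
    limsup (fun σ => ((w σ : ℝ) : EReal)) atTop ≤ (((A2 / B1) ^ (1 / ρ) : ℝ) : EReal) := by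
  have step : ∀ c T : ℝ, 0 < c → c < T ^ (1 / ρ) → 0 < T → c ^ ρ < T := by
    intro c T hc h hT
    have := Real.rpow_lt_rpow hc.le h hρ
    rwa [← Real.rpow_mul hT.le, one_div, inv_mul_cancel₀ hρ.ne', Real.rpow_one] at this
  refine ⟨?_, ?_, ?_⟩
  · by_contra hcon
    obtain ⟨c, h1, h2⟩ := EReal.lt_iff_exists_real_btwn.1 (not_le.1 hcon)
    have h2 : c < (A1 / B1) ^ (1 / ρ) := by exact_mod_cast h2
    have h3 := eventually_lt_of_limsup_lt h1
    have hc : 0 < c := by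
      obtain ⟨σ, h4, h5⟩ := (h3.and hw).exists
      have h4 : w σ < c := by exact_mod_cast h4
      linarith
    have hcρ : 0 < c ^ ρ := Real.rpow_pos_of_pos hc _
    have h6 := step c _ hc h2 (div_pos pA1 pB1)
    rw [lt_div_iff₀ pB1] at h6
    obtain ⟨a', h7, h8⟩ := exists_between h6
    have h9 : ((a' : ℝ) : EReal) < liminf (fun σ => ((a σ : ℝ) : EReal)) atTop := by
      rw [hA1]; exact_mod_cast h8
    have h10 : ((a' / c ^ ρ : ℝ) : EReal) ≤ liminf (fun σ => ((b σ : ℝ) : EReal)) atTop := by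
      refine le_liminf_of_le (by isBoundedDefault) ?_
      filter_upwards [h3, eventually_lt_of_lt_liminf h9, hw, hb, hwab] with σ k1 k2 k3 k4 k5
      have k1 : w σ < c := by exact_mod_cast k1
      have k2 : a' < a σ := by exact_mod_cast k2
      have : w σ ^ ρ * b σ ≤ c ^ ρ * b σ := by gcongr
      have : a' / c ^ ρ ≤ b σ := by
        rw [div_le_iff₀ hcρ]; linarith
      exact_mod_cast this
    rw [hB1] at h10
    have h10 : a' / c ^ ρ ≤ B1 := by exact_mod_cast h10
    rw [div_le_iff₀ hcρ] at h10
    linarith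
  · by_contra hcon
    obtain ⟨c, h1, h2⟩ := EReal.lt_iff_exists_real_btwn.1 (not_le.1 hcon)
    have h2 : c < (A2 / B2) ^ (1 / ρ) := by exact_mod_cast h2
    have h3 := eventually_lt_of_limsup_lt h1
    have hc : 0 < c := by
      obtain ⟨σ, h4, h5⟩ := (h3.and hw).exists
      have h4 : w σ < c := by exact_mod_cast h4
      linarith
    have hcρ : 0 < c ^ ρ := Real.rpow_pos_of_pos hc _
    have h6 := step c _ hc h2 (div_pos pA2 pB2)
    rw [lt_div_iff₀ pB2, ← lt_div_iff₀' hcρ] at h6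
    obtain ⟨b', h7, h8⟩ := exists_between h6
    have h9 : limsup (fun σ => ((b σ : ℝ) : EReal)) atTop < ((b' : ℝ) : EReal) := by
      rw [hB2]; exact_mod_cast h7
    have h10 : limsup (fun σ => ((a σ : ℝ) : EReal)) atTop ≤ ((c ^ ρ * b' : ℝ) : EReal) := by
      refine limsup_le_of_le (by isBoundedDefault) ?_
      filter_upwards [h3, eventually_lt_of_limsup_lt h9, hw, hb, hwab] with σ k1 k2 k3 k4 k5
      have k1 : w σ < c := by exact_mod_cast k1
      have k2 : b σ < b' := by exact_mod_cast k2
      have : w σ ^ ρ * b σ ≤ c ^ ρ * b' := by gcongr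
      rw [k5] at this
      exact_mod_cast this
    rw [hA2] at h10
    have h10 : A2 ≤ c ^ ρ * b' := by exact_mod_cast h10
    rw [lt_div_iff₀' hcρ] at h8
    linarith
  · by_contra hcon
    obtain ⟨c, h1, h2⟩ := EReal.lt_iff_exists_real_btwn.1 (not_le.1 hcon)
    have h1 : (A2 / B1) ^ (1 / ρ) < c := by exact_mod_cast h1
    have hT : 0 < A2 / B1 := div_pos pA2 pB1
    have hc : 0 < c := (Real.rpow_pos_of_pos hT _).trans h1
    have hcρ : 0 < c ^ ρ := Real.rpow_pos_of_pos hc _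
    have h6 : A2 / B1 < c ^ ρ := by
      have := Real.rpow_lt_rpow (Real.rpow_pos_of_pos hT _).le h1 hρ
      rwa [← Real.rpow_mul hT.le, one_div, inv_mul_cancel₀ hρ.ne', Real.rpow_one] at this
    rw [div_lt_iff₀ pB1] at h6
    obtain ⟨a', h7, h8⟩ := exists_between h6
    rw [← div_lt_iff₀' hcρ] at h8
    have h9 : limsup (fun σ => ((a σ : ℝ) : EReal)) atTop < ((a' : ℝ) : EReal) := by
      rw [hA2]; exact_mod_cast h7
    have h10 : ((a' / c ^ ρ : ℝ) : EReal) < liminf (fun σ => ((b σ : ℝ) : EReal)) atTop := by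
      rw [hB1]; exact_mod_cast h8
    refine absurd h2 (not_lt.2 ?_)
    refine limsup_le_of_le (by isBoundedDefault) ?_
    filter_upwards [eventually_lt_of_limsup_lt h9, eventually_lt_of_lt_liminf h10, hw, hb, hwab]
      with σ k1 k2 k3 k4 k5
    have k1 : a σ < a' := by exact_mod_cast k1
    have k2 : a' / c ^ ρ < b σ := by exact_mod_cast k2
    rw [div_lt_iff₀ hcρ] at k2
    have : w σ ≤ c := by
      by_contra hcw
      have : c ^ ρ * b σ ≤ w σ ^ ρ * b σ := by
        have := (not_le.1 hcw).le
        gcongr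
      linarith
    exact_mod_cast this

/-- Two-sided comparison with two powers forces equality of the exponents. -/
lemma exponent_unique {B y : ℝ → ℝ} (hy : Tendsto y atTop atTop) {α β c d C D : ℝ}
    (hc : 0 < c) (hd : 0 < d)
    (h1 : ∀ᶠ σ in atTop, c < B σ / y σ ^ α) (h2 : ∀ᶠ σ in atTop, B σ / y σ ^ α < C)
    (h3 : ∀ᶠ σ in atTop, d < B σ / y σ ^ β) (h4 : ∀ᶠ σ in atTop, B σ / y σ ^ β < D) :
    α = β := by
  have main : ∀ {α β c D : ℝ}, 0 < c → (∀ᶠ σ in atTop, c < B σ / y σ ^ α) →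
      (∀ᶠ σ in atTop, B σ / y σ ^ β < D) → α ≤ β := by
    intro α β c D hc h1 h4
    by_contra hlt
    have hlt : 0 < α - β := by linarith
    have ht := (tendsto_rpow_atTop hlt).comp hy
    obtain ⟨σ, k1, k2, k3, k4⟩ := (h1.and (h4.and ((hy.eventually (eventually_gt_atTop 0)).and
      (ht.eventually (eventually_ge_atTop (D / c)))))).exists
    have pa := Real.rpow_pos_of_pos k3 α
    have pb := Real.rpow_pos_of_pos k3 β
    rw [lt_div_iff₀ pa] at k1
    rw [div_lt_iff₀ pb] at k2
    simp only [Function.comp] at k4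
    rw [Real.rpow_sub k3, div_le_div_iff₀ hc pb] at k4
    linarith
  exact le_antisymm (main hc h1 h4) (main hd h3 h2)

lemma iter_log_tendsto (k : ℕ) : Tendsto (Real.log^[k]) atTop atTop := by
  induction k with
  | zero => exact tendsto_id
  | succ k ih =>
    rw [Function.iterate_succ']
    exact Real.tendsto_log_atTop.comp ih

/-- Comparison with a power gives the logarithmic limit. -/
lemma log_ratio {A x : ℝ → ℝ} (hx : Tendsto x atTop atTop) (hA : Tendsto A atTop atTop)
    {ρ c C : ℝ} (hc : 0 < c)
    (h1 : ∀ᶠ σ in atTop, c < A σ / x σ ^ ρ) (h2 : ∀ᶠ σ in atTop, A σ / x σ ^ ρ < C) :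
    Tendsto (fun σ => Real.log (A σ) / Real.log (x σ)) atTop (𝓝 ρ) := by
  have hlx : Tendsto (fun σ => Real.log (x σ)) atTop atTop := Real.tendsto_log_atTop.comp hx
  have hl : Tendsto (fun σ => Real.log c / Real.log (x σ) + ρ) atTop (𝓝 ρ) := by
    simpa using (hlx.const_div_atTop (Real.log c)).add_const ρ
  have hu : Tendsto (fun σ => Real.log C / Real.log (x σ) + ρ) atTop (𝓝 ρ) := by
    simpa using (hlx.const_div_atTop (Real.log C)).add_const ρ
  refine tendsto_of_tendsto_of_tendsto_of_le_of_le' hl hu ?_ ?_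
  · filter_upwards [h1, hx.eventually (eventually_gt_atTop 0),
      hlx.eventually (eventually_gt_atTop 0)] with σ k1 k2 k3
    have px := Real.rpow_pos_of_pos k2 ρ
    rw [lt_div_iff₀ px] at k1
    have := Real.log_le_log (by positivity) k1.le
    rw [Real.log_mul hc.ne' px.ne', Real.log_rpow k2] at this
    rw [div_add' _ _ _ k3.ne', div_le_div_iff_of_pos_right k3]
    exact this
  · filter_upwards [h1, h2, hx.eventually (eventually_gt_atTop 0),
      hlx.eventually (eventually_gt_atTop 0), hA.eventually (eventually_gt_atTop 0)]
      with σ k0 k1 k2 k3 k4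
    have px := Real.rpow_pos_of_pos k2 ρ
    have hC : 0 < C := hc.trans (k0.trans k1)
    rw [div_lt_iff₀ px] at k1
    have := Real.log_le_log k4 k1.le
    rw [Real.log_mul hC.ne' px.ne', Real.log_rpow k2] at this
    rw [div_add' _ _ _ k3.ne', div_le_div_iff_of_pos_right k3]
    exact this

/-- The hypotheses force `m = 0 ↔ q = 0`. -/
lemma zero_iff {U : ℝ → ℝ} (hU : Tendsto U atTop atTop) (m q : ℕ) {ρ c C d D : ℝ}
    (hρ : 0 < ρ) (hc : 0 < c) (hd : 0 < d)
    (h1 : ∀ᶠ σ in atTop, c < Real.log^[m] (U σ) / Real.log^[q] σ)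
    (h2 : ∀ᶠ σ in atTop, Real.log^[m] (U σ) / Real.log^[q] σ < C)
    (h3 : ∀ᶠ σ in atTop, d < Real.log^[m-1] (U σ) / (Real.log^[q-1] σ) ^ ρ)
    (h4 : ∀ᶠ σ in atTop, Real.log^[m-1] (U σ) / (Real.log^[q-1] σ) ^ ρ < D) :
    (m = 0 ↔ q = 0) := by
  constructor
  · rintro rfl
    rcases q with _ | q
    · rfl
    exfalso
    simp only [Nat.zero_sub, Nat.add_sub_cancel, Function.iterate_zero, id,
      Function.iterate_succ', Function.comp] at h1 h2 h3 h4
    have hx := iter_log_tendsto q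
    set x := Real.log^[q]
    have hCpos : 0 < C := by
      obtain ⟨σ, k1, k2⟩ := (h1.and h2).exists
      linarith
    have ho := (isLittleO_log_rpow_atTop hρ).def (div_pos hd hCpos)
    obtain ⟨σ, k1, k2, k3, k4, k5⟩ := (h2.and (h3.and ((hx.eventually (eventually_gt_atTop 0)).and
      (((Real.tendsto_log_atTop.comp hx).eventually (eventually_gt_atTop 0)).and
        (hx.eventually ho))))).exists
    simp only [Function.comp] at k4
    have px := Real.rpow_pos_of_pos k3 ρ
    rw [Real.norm_of_nonneg k4.le, Real.norm_of_nonneg px.le, div_mul_eq_mul_div,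
      le_div_iff₀ hCpos] at k5
    rw [div_lt_iff₀ k4] at k1
    rw [lt_div_iff₀ px] at k2
    linarith
  · rintro rfl
    rcases m with _ | m
    · rfl
    exfalso
    simp only [Nat.zero_sub, Nat.add_sub_cancel, Function.iterate_zero, id,
      Function.iterate_succ', Function.comp] at h1 h2 h3 h4
    have hA := (iter_log_tendsto m).comp hU
    have hr := log_ratio (A := fun σ => Real.log^[m] (U σ)) (x := fun σ => σ) tendsto_id hA hd h3 h4
    have ho := Real.isLittleO_log_id_atTop.def (show 0 < c / (ρ + 1) by positivity)
    obtain ⟨σ, k1, k2, k3, k4, k5⟩ := (h1.and ((hr.eventually (gt_mem_nhds (show ρ < ρ + 1 by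
      linarith))).and ((eventually_gt_atTop (0 : ℝ)).and
      ((Real.tendsto_log_atTop.eventually (eventually_gt_atTop 0)).and ho)))).exists
    simp only [id] at k5
    rw [Real.norm_of_nonneg k4.le, Real.norm_of_nonneg k3.le, div_mul_eq_mul_div,
      le_div_iff₀ (by positivity)] at k5
    rw [div_lt_iff₀ k4] at k2
    rw [lt_div_iff₀ k3] at k1
    linarith

lemma limsup_eq_of_tendsto_real {u : ℝ → ℝ} {l : ℝ} (h : Tendsto u atTop (𝓝 l)) :
    limsup (fun σ => ((u σ : ℝ) : EReal)) atTop = (l : EReal) :=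
  ((continuous_coe_real_ereal.tendsto l).comp h).limsup_eq

end PartTwo

section PartThree

lemma limsup_rel (f : VVDS E) (g : VVDS F) (u : ℝ → EReal) :
    limsup (fun σ => u (g.Minv (f.M σ))) atTop = limsup u atTop := by
  have := limsup_comp u (fun σ => g.Minv (f.M σ)) atTop
  rw [f.rel_map g] at this
  exact this

lemma liminf_rel (f : VVDS E) (g : VVDS F) (u : ℝ → EReal) :
    liminf (fun σ => u (g.Minv (f.M σ))) atTop = liminf u atTop := by
  have := liminf_comp u (fun σ => g.Minv (f.M σ)) atTop
  rw [f.rel_map g] at this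
  exact this

lemma coe_toReal_of {x : EReal} (h0 : 0 < x) (h1 : x < ⊤) : x = ((x.toReal : ℝ) : EReal) :=
  (EReal.coe_toReal h1.ne (ne_bot_of_gt h0)).symm

end PartThree

theorem stmt_10 (f : VVDS E) (g : VVDS F) (h : VVDS G) (p q m : ℕ)
    (hf1 : (0 : EReal) < relRittLowerOrder m q f h)
    (hf2 : relRittLowerOrder m q f h ≤ relRittOrder m q f h)
    (hf3 : relRittOrder m q f h < ⊤)
    (hg1 : (0 : EReal) < relRittLowerOrder m p g h)
    (hg2 : relRittLowerOrder m p g h ≤ relRittOrder m p g h)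
    (hg3 : relRittOrder m p g h < ⊤)
    (hDf1 : (0 : EReal) < relRittType m q f h)
    (hDf2 : relRittType m q f h < ⊤)
    (hDbf1 : (0 : EReal) < relRittLowerType m q f h)
    (hDbf2 : relRittLowerType m q f h < ⊤)
    (hDg1 : (0 : EReal) < relRittType m p g h)
    (hDg2 : relRittType m p g h < ⊤)
    (hDbg1 : (0 : EReal) < relRittLowerType m p g h)
    (hDbg2 : relRittLowerType m p g h < ⊤)
    (htg1 : (0 : EReal) < relRittWeakType m p g h)
    (htg2 : relRittWeakType m p g h < ⊤)
    (htbg1 : (0 : EReal) < relRittUpperWeakType m p g h)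
    (htbg2 : relRittUpperWeakType m p g h < ⊤)
    :
    ((max (((relRittLowerType m q f h).toReal / (relRittWeakType m p g h).toReal) ^ (1 / (relRittLowerOrder m p g h).toReal)) (((relRittType m q f h).toReal / (relRittUpperWeakType m p g h).toReal) ^ (1 / (relRittLowerOrder m p g h).toReal)) : ℝ) : EReal) ≤ relRittType p q f g ∧ relRittType p q f g ≤ (((((relRittType m q f h).toReal / (relRittLowerType m p g h).toReal) ^ (1 / (relRittOrder m p g h).toReal)) : ℝ) : EReal) := by
  have hlf3 := hf2.trans_lt hf3
  have hg1' := hg1.trans_le hg2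
  have hlg3 := hg2.trans_lt hg3
  have hf1' := hf1.trans_le hf2
  have eρf := coe_toReal_of hf1' hf3
  have elf := coe_toReal_of hf1 hlf3
  have eρg := coe_toReal_of hg1' hg3
  have elg := coe_toReal_of hg1 hlg3
  have eDf := coe_toReal_of hDf1 hDf2
  have eDbf := coe_toReal_of hDbf1 hDbf2
  have eDg := coe_toReal_of hDg1 hDg2
  have eDbg := coe_toReal_of hDbg1 hDbg2
  have pρf := EReal.toReal_pos hf1' hf3.ne
  have plf := EReal.toReal_pos hf1 hlf3.ne
  have pρg := EReal.toReal_pos hg1' hg3.ne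
  have plg := EReal.toReal_pos hg1 hlg3.ne
  have pDf := EReal.toReal_pos hDf1 hDf2.ne
  have pDbf := EReal.toReal_pos hDbf1 hDbf2.ne
  have pDg := EReal.toReal_pos hDg1 hDg2.ne
  have pDbg := EReal.toReal_pos hDbg1 hDbg2.ne
  obtain ⟨cf, hcf, of1⟩ := ev_lower hf1
  obtain ⟨Cf, of2⟩ := ev_upper hf3
  obtain ⟨df, hdf, tf1⟩ := ev_lower hDbf1
  obtain ⟨Df, tf2⟩ := ev_upper hDf2
  obtain ⟨cg, hcg, og1⟩ := ev_lower hg1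
  obtain ⟨Cg, og2⟩ := ev_upper hg3
  obtain ⟨dg, hdg, tg1⟩ := ev_lower hDbg1
  obtain ⟨Dg, tg2⟩ := ev_upper hDg2
  obtain ⟨eg, heg, wg1⟩ := ev_lower htg1
  obtain ⟨Eg, wg2⟩ := ev_upper htbg2
  have huf := f.rel_tendsto h
  have hug := g.rel_tendsto h
  have hv := f.rel_tendsto g
  have zf := zero_iff huf m q pρf hcf hdf of1 of2 tf1 tf2
  have zg := zero_iff hug m p pρg hcg hdg og1 og2 tg1 tg2
  -- lower order and order of `g` agree
  have hlr : (relRittLowerOrder m p g h).toReal = (relRittOrder m p g h).toReal :=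
    exponent_unique (iter_log_tendsto (p - 1)) heg hdg wg1 wg2 tg1 tg2
  have hwt : relRittWeakType m p g h = relRittLowerType m p g h := by
    unfold relRittWeakType relRittLowerType; rw [hlr]
  have huwt : relRittUpperWeakType m p g h = relRittType m p g h := by
    unfold relRittUpperWeakType relRittType; rw [hlr]
  rw [hwt, huwt, hlr]
  -- the order of `f` with respect to `g`
  have hord : relRittOrder p q f g =
      (((relRittOrder m q f h).toReal / (relRittOrder m p g h).toReal : ℝ) : EReal) := by
    rcases m with _ | m
    · obtain rfl := zf.1 rfl
      obtain rfl := zg.1 rfl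
      have r1 : (relRittOrder 0 0 f h).toReal = 1 := by
        refine exponent_unique (B := fun σ => h.Minv (f.M σ)) (y := fun σ => σ) tendsto_id
          hdf hcf tf1 tf2 ?_ ?_ (D := Cf)
        · simpa using of1
        · simpa using of2
      have r2 : (relRittOrder 0 0 g h).toReal = 1 := by
        refine exponent_unique (B := fun σ => h.Minv (g.M σ)) (y := fun σ => σ) tendsto_id
          hdg hcg tg1 tg2 ?_ ?_ (D := Cg)
        · simpa using og1
        · simpa using og2
      have hb1 := liminf_rel f g (fun r => ((h.Minv (g.M r) / r : ℝ) : EReal))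
      have hb2 := limsup_rel f g (fun r => ((h.Minv (g.M r) / r : ℝ) : EReal))
      simp only [VVDS.rel_comp] at hb1 hb2
      have key := quot_lemma (a := fun σ => h.Minv (f.M σ) / σ)
        (b := fun σ => h.Minv (f.M σ) / g.Minv (f.M σ)) (w := fun σ => g.Minv (f.M σ) / σ)
        one_pos elf eρf (hb1.trans elg) (hb2.trans eρg) plf pρf plg pρg ?_ ?_ ?_
      · rw [hlr, r1, r2] at key
        rw [r1, r2]
        have e1 := key.2.1
        have e2 := key.2.2
        simp only [div_one, Real.one_rpow] at e1 e2
        rw [div_one]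
        exact le_antisymm e2 e1
      · filter_upwards [hv.eventually (eventually_gt_atTop 0), eventually_gt_atTop (0 : ℝ)]
          with σ k1 k2
        exact div_pos k1 k2
      · filter_upwards [hv.eventually (eventually_gt_atTop 0),
          huf.eventually (eventually_gt_atTop 0)] with σ k1 k2
        exact div_pos k2 k1
      · filter_upwards [hv.eventually (eventually_gt_atTop 0), eventually_gt_atTop (0 : ℝ)]
          with σ k1 k2
        rw [Real.rpow_one]
        field_simp
    · obtain ⟨q, rfl⟩ := Nat.exists_eq_succ_of_ne_zero (fun hq => Nat.succ_ne_zero m (zf.2 hq))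
      obtain ⟨p, rfl⟩ := Nat.exists_eq_succ_of_ne_zero (fun hp => Nat.succ_ne_zero m (zg.2 hp))
      have L1 := log_ratio (iter_log_tendsto q) ((iter_log_tendsto m).comp huf) hdf tf1 tf2
      have L2 := log_ratio (iter_log_tendsto p) ((iter_log_tendsto m).comp hug) hdg tg1 tg2
      have L3 := L2.comp hv
      have L4 := L1.div L3 pρg.ne'
      unfold relRittOrder
      apply limsup_eq_of_tendsto_real
      refine L4.congr' ?_
      filter_upwards [((iter_log_tendsto (m + 1)).comp huf).eventually (eventually_gt_atTop 0)]
        with σ k1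
      simp only [Function.iterate_succ', Function.comp, VVDS.rel_comp, Pi.div_apply] at k1 ⊢
      rw [div_div_div_comm, div_self k1.ne', one_div_div]
  have hb1 := liminf_rel f g (fun r => ((Real.log^[m-1] (h.Minv (g.M r)) /
      (Real.log^[p-1] r) ^ (relRittOrder m p g h).toReal : ℝ) : EReal))
  have hb2 := limsup_rel f g (fun r => ((Real.log^[m-1] (h.Minv (g.M r)) /
      (Real.log^[p-1] r) ^ (relRittOrder m p g h).toReal : ℝ) : EReal))
  simp only [VVDS.rel_comp] at hb1 hb2
  have hx := (iter_log_tendsto (q - 1)).eventually (eventually_gt_atTop 0)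
  have hV := ((iter_log_tendsto (p - 1)).comp hv).eventually (eventually_gt_atTop 0)
  have hA := ((iter_log_tendsto (m - 1)).comp huf).eventually (eventually_gt_atTop 0)
  have key := quot_lemma
    (w := fun σ => Real.log^[p-1] (g.Minv (f.M σ)) /
      (Real.log^[q-1] σ) ^ (relRittOrder p q f g).toReal)
    pρg eDbf eDf (hb1.trans eDbg) (hb2.trans eDg) pDbf pDf pDbg pDg ?_ ?_ ?_
  · refine ⟨?_, key.2.2⟩
    rcases max_cases (((relRittLowerType m q f h).toReal / (relRittLowerType m p g h).toReal) ^
      (1 / (relRittOrder m p g h).toReal)) (((relRittType m q f h).toReal /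
      (relRittType m p g h).toReal) ^ (1 / (relRittOrder m p g h).toReal)) with hm | hm
    · rw [hm.1]; exact key.1
    · rw [hm.1]; exact key.2.1
  · filter_upwards [hx, hV] with σ k1 k2
    exact div_pos k2 (Real.rpow_pos_of_pos k1 _)
  · filter_upwards [hA, hV] with σ k1 k2
    exact div_pos k1 (Real.rpow_pos_of_pos k2 _)
  · filter_upwards [hx, hV] with σ k1 k2
    simp only [Function.comp] at k2
    rw [hord, EReal.toReal_coe, Real.div_rpow k2.le (Real.rpow_pos_of_pos k1 _).le,
      ← Real.rpow_mul k1.le, div_mul_cancel₀ _ pρg.ne']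
    have := Real.rpow_pos_of_pos k1 (relRittOrder m q f h).toReal
    have := Real.rpow_pos_of_pos k2 (relRittOrder m p g h).toReal
    field_simp
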